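/- Let G = {(a, b, c + mπ + ne) ∈ ℝ³ : a, b, c, m, n ∈ ℤ}, i.e., G = ℤ² × G₀ where G₀ is the additive subgroup of ℝ generated by 1, π, and e. Then h(G) ≥ 9: there exist nine convex subsets F₁, …, F₉ of ℝ³ such that any eight of them have a common point belonging to G, but the intersection of all nine contains no point of G. In particular, there is an additive subgroup of ℝ³ whose Helly number exceeds 2³ = 8. -/

import Mathlib

def HellyLe {d : ℕ} (S : Set (EuclideanSpace ℝ (Fin d))) (n : ℕ) : Prop :=
  ∀ (m : ℕ) (F : Fin m → Set (EuclideanSpace ℝ (Fin d))),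
    (∀ i, Convex ℝ (F i)) →
    (∀ I : Finset (Fin m), I.card ≤ n → (S ∩ ⋂ i ∈ I, F i).Nonempty) →
    (S ∩ ⋂ i, F i).Nonempty

/-- The subgroup `G = ℤ² × G₀` of `ℝ³`, where `G₀` is the additive subgroup of `ℝ`
generated by `1`, `π` and `e`. -/
def G13 : Set (EuclideanSpace ℝ (Fin 3)) :=
  {x | ∃ a b c m n : ℤ,
    x 0 = (a : ℝ) ∧ x 1 = (b : ℝ) ∧ x 2 = (c : ℝ) + (m : ℝ) * Real.pi + (n : ℝ) * Real.exp 1}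

/-- A finitely generated additive subgroup of `ℝ` containing `1` and an irrational number has at
least three nonzero classes modulo `2`. -/
theorem exists_half_notMem {H : AddSubgroup ℝ} (hfg : H.FG) (h1 : (1 : ℝ) ∈ H) {x : ℝ}
    (hx : Irrational x) (hxH : x ∈ H) :
    ∃ v ∈ H, ∃ w ∈ H, v / 2 ∉ H ∧ w / 2 ∉ H ∧ (v + w) / 2 ∉ H := by
  have : Module.Finite ℤ H :=
    Module.Finite.iff_addGroup_fg.2 (AddGroup.fg_iff_addSubgroup_fg H |>.2 hfg)
  let b := Module.finBasis ℤ H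
  have hli : LinearIndependent ℤ ![(⟨1, h1⟩ : H), ⟨x, hxH⟩] := by
    rw [LinearIndependent.pair_iff]
    intro s t hst
    have hst' : (s : ℝ) + t * x = 0 := by
      simpa using congrArg (Subtype.val : H → ℝ) hst
    have ht : t = 0 := by
      by_contra ht
      exact ((hx.intCast_mul ht).intCast_add s).ne_zero hst'
    subst ht
    exact ⟨by simpa using hst', rfl⟩
  have hcard : 2 ≤ Module.finrank ℤ H := by
    simpa using hli.fintype_card_le_finrank
  let i : Fin (Module.finrank ℤ H) := ⟨0, by omega⟩
  let j : Fin (Module.finrank ℤ H) := ⟨1, by omega⟩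
  have hij : i ≠ j := by simp [i, j]
  have hodd : ∀ (g : H) (k : Fin (Module.finrank ℤ H)), b.repr g k = 1 → (g : ℝ) / 2 ∉ H := by
    intro g k hk hg
    have hg2 : g = (2 : ℤ) • (⟨(g : ℝ) / 2, hg⟩ : H) := by
      ext
      simp only [AddSubgroup.coe_zsmul, zsmul_eq_mul]
      push_cast
      ring
    rw [hg2, map_zsmul, Finsupp.smul_apply, smul_eq_mul] at hk
    omega
  refine ⟨b i, (b i).2, b j, (b j).2, hodd _ i (by simp), hodd _ j (by simp), ?_⟩
  exact hodd (b i + b j) i (by simp [hij.symm])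

/-- Nine half-spaces of `ℝ³`: the first three cut the corners off a triangular prism, the others
bound a region that degenerates, over the sides of the triangle, to the plane
`z = (v x + w y) / 2`. -/
def cornerHalfSpace (v w N : ℝ) : Fin 9 → Set (EuclideanSpace ℝ (Fin 3)) :=
  ![{p | 1 ≤ p 0 + p 1},
    {p | p 0 ≤ 1},
    {p | p 1 ≤ 1},
    {p | (v * p 0 + w * p 1) / 2 - 2 * N * p 1 ≤ p 2},
    {p | p 2 ≤ (v * p 0 + w * p 1) / 2 + 2 * N * p 1},
    {p | (v * p 0 + w * p 1) / 2 - 2 * N * p 0 ≤ p 2},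
    {p | p 2 ≤ (v * p 0 + w * p 1) / 2 + 2 * N * p 0},
    {p | (v * p 0 + w * p 1) / 2 - 2 * N * (2 - p 0 - p 1) ≤ p 2},
    {p | p 2 ≤ (v * p 0 + w * p 1) / 2 + 2 * N * (2 - p 0 - p 1)}]

theorem convex_affine_le (α β γ δ : ℝ) :
    Convex ℝ {p : EuclideanSpace ℝ (Fin 3) | α * p 0 + β * p 1 + γ * p 2 ≤ δ} := by
  intro p hp q hq s t hs ht hst
  simp only [Set.mem_ofPred_eq, PiLp.add_apply, PiLp.smul_apply, smul_eq_mul] at hp hq ⊢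
  have hδ : δ = s * δ + t * δ := by rw [← add_mul, hst, one_mul]
  linarith [mul_le_mul_of_nonneg_left hp hs, mul_le_mul_of_nonneg_left hq ht]

theorem convex_cornerHalfSpace (v w N : ℝ) (i : Fin 9) :
    Convex ℝ (cornerHalfSpace v w N i) := by
  have key : ∀ (s : Set (EuclideanSpace ℝ (Fin 3))) (α β γ δ : ℝ),
      (∀ p, p ∈ s ↔ α * p 0 + β * p 1 + γ * p 2 ≤ δ) → Convex ℝ s := fun s α β γ δ h ↦ by
    rw [show s = {p | α * p 0 + β * p 1 + γ * p 2 ≤ δ} from Set.ext h]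
    exact convex_affine_le α β γ δ
  fin_cases i
  · refine key _ (-1) (-1) 0 (-1) fun p ↦ ?_
    change 1 ≤ p 0 + p 1 ↔ _
    constructor <;> intro h <;> linarith
  · refine key _ 1 0 0 1 fun p ↦ ?_
    change p 0 ≤ 1 ↔ _
    constructor <;> intro h <;> linarith
  · refine key _ 0 1 0 1 fun p ↦ ?_
    change p 1 ≤ 1 ↔ _
    constructor <;> intro h <;> linarith
  · refine key _ (v / 2) (w / 2 - 2 * N) (-1) 0 fun p ↦ ?_
    change (v * p 0 + w * p 1) / 2 - 2 * N * p 1 ≤ p 2 ↔ _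
    constructor <;> intro h <;> linarith
  · refine key _ (-v / 2) (-w / 2 - 2 * N) 1 0 fun p ↦ ?_
    change p 2 ≤ (v * p 0 + w * p 1) / 2 + 2 * N * p 1 ↔ _
    constructor <;> intro h <;> linarith
  · refine key _ (v / 2 - 2 * N) (w / 2) (-1) 0 fun p ↦ ?_
    change (v * p 0 + w * p 1) / 2 - 2 * N * p 0 ≤ p 2 ↔ _
    constructor <;> intro h <;> linarith
  · refine key _ (-v / 2 - 2 * N) (-w / 2) 1 0 fun p ↦ ?_
    change p 2 ≤ (v * p 0 + w * p 1) / 2 + 2 * N * p 0 ↔ _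
    constructor <;> intro h <;> linarith
  · refine key _ (v / 2 + 2 * N) (w / 2 + 2 * N) (-1) (4 * N) fun p ↦ ?_
    change (v * p 0 + w * p 1) / 2 - 2 * N * (2 - p 0 - p 1) ≤ p 2 ↔ _
    constructor <;> intro h <;> linarith
  · refine key _ (-v / 2 + 2 * N) (-w / 2 + 2 * N) 1 (4 * N) fun p ↦ ?_
    change p 2 ≤ (v * p 0 + w * p 1) / 2 + 2 * N * (2 - p 0 - p 1) ↔ _
    constructor <;> intro h <;> linarith

/-- The points of `ℝ³` witnessing that any eight of the sets `cornerHalfSpace v w N` meet. -/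
noncomputable def cornerPoint (v w N : ℝ) : Fin 9 → EuclideanSpace ℝ (Fin 3) :=
  ![!₂[0, 0, 0], !₂[2, 0, v], !₂[0, 2, w], !₂[1, 0, -N], !₂[1, 0, N], !₂[0, 1, -N], !₂[0, 1, N],
    !₂[1, 1, -N], !₂[1, 1, N]]

set_option maxHeartbeats 1000000 in
theorem cornerPoint_mem_cornerHalfSpace {v w N : ℝ} (hv : |v| ≤ N) (hw : |w| ≤ N) {i j : Fin 9}
    (hij : j ≠ i) : cornerPoint v w N i ∈ cornerHalfSpace v w N j := by
  rw [abs_le] at hv hw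
  obtain ⟨hv₁, hv₂⟩ := hv
  obtain ⟨hw₁, hw₂⟩ := hw
  fin_cases i <;> fin_cases j <;>
    first
    | exact absurd rfl hij
    | (clear hij; simp [cornerPoint, cornerHalfSpace] <;> linarith)

/-- The additive subgroup of `ℝ` generated by `1`, `π` and `e`. -/
noncomputable def onePiExp : AddSubgroup ℝ :=
  (Submodule.span ℤ {1, Real.pi, Real.exp 1}).toAddSubgroup

theorem mem_onePiExp {z : ℝ} :
    z ∈ onePiExp ↔ ∃ c m n : ℤ, z = (c : ℝ) + (m : ℝ) * Real.pi + (n : ℝ) * Real.exp 1 := by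
  simp only [onePiExp, Submodule.mem_toAddSubgroup, Submodule.mem_span_triple, zsmul_eq_mul,
    mul_one, eq_comm]

theorem fg_onePiExp : onePiExp.FG := by
  rw [onePiExp, ← Submodule.fg_iff_addSubgroup_fg]
  exact Submodule.fg_span (by simp)

theorem mem_G13_iff {p : EuclideanSpace ℝ (Fin 3)} :
    p ∈ G13 ↔ (∃ a : ℤ, p 0 = a) ∧ (∃ b : ℤ, p 1 = b) ∧ p 2 ∈ onePiExp := by
  rw [mem_onePiExp]
  constructor
  · rintro ⟨a, b, c, m, n, ha, hb, h⟩
    exact ⟨⟨a, ha⟩, ⟨b, hb⟩, c, m, n, h⟩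
  · rintro ⟨⟨a, ha⟩, ⟨b, hb⟩, c, m, n, h⟩
    exact ⟨a, b, c, m, n, ha, hb, h⟩

theorem cornerPoint_mem_G13 {v w N : ℝ} (hv : v ∈ onePiExp) (hw : w ∈ onePiExp)
    (hN : N ∈ onePiExp) (i : Fin 9) : cornerPoint v w N i ∈ G13 := by
  have h0 : ∃ a : ℤ, (0 : ℝ) = a := ⟨0, by simp⟩
  have h1 : ∃ a : ℤ, (1 : ℝ) = a := ⟨1, by simp⟩
  have h2 : ∃ a : ℤ, (2 : ℝ) = a := ⟨2, by simp⟩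
  have hz : (0 : ℝ) ∈ onePiExp := zero_mem _
  have hN' : -N ∈ onePiExp := neg_mem hN
  rw [mem_G13_iff]
  fin_cases i <;> refine ⟨?_, ?_, ?_⟩ <;> assumption

theorem G13_inter_iInter_cornerHalfSpace {v w N : ℝ} (hv : v / 2 ∉ onePiExp)
    (hw : w / 2 ∉ onePiExp) (hvw : (v + w) / 2 ∉ onePiExp) :
    G13 ∩ ⋂ i, cornerHalfSpace v w N i = ∅ := by
  rw [Set.eq_empty_iff_forall_notMem]
  rintro p ⟨hp, hF⟩
  obtain ⟨⟨a, ha⟩, ⟨b, hb⟩, hz⟩ := mem_G13_iff.1 hp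
  rw [Set.mem_iInter] at hF
  have h0 : (1 : ℝ) ≤ a + b := by rw [← ha, ← hb]; exact hF 0
  have h1 : (a : ℝ) ≤ 1 := by rw [← ha]; exact hF 1
  have h2 : (b : ℝ) ≤ 1 := by rw [← hb]; exact hF 2
  have h3 : (v * a + w * b) / 2 - 2 * N * b ≤ p 2 := by rw [← ha, ← hb]; exact hF 3
  have h4 : p 2 ≤ (v * a + w * b) / 2 + 2 * N * b := by rw [← ha, ← hb]; exact hF 4
  have h5 : (v * a + w * b) / 2 - 2 * N * a ≤ p 2 := by rw [← ha, ← hb]; exact hF 5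
  have h6 : p 2 ≤ (v * a + w * b) / 2 + 2 * N * a := by rw [← ha, ← hb]; exact hF 6
  have h7 : (v * a + w * b) / 2 - 2 * N * (2 - a - b) ≤ p 2 := by rw [← ha, ← hb]; exact hF 7
  have h8 : p 2 ≤ (v * a + w * b) / 2 + 2 * N * (2 - a - b) := by rw [← ha, ← hb]; exact hF 8
  norm_cast at h0 h1 h2
  obtain ⟨rfl, rfl⟩ | ⟨rfl, rfl⟩ | ⟨rfl, rfl⟩ :
      a = 1 ∧ b = 0 ∨ a = 0 ∧ b = 1 ∨ a = 1 ∧ b = 1 := by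
    omega
  · refine hv ?_
    convert hz using 1
    push_cast at h3 h4
    linarith
  · refine hw ?_
    convert hz using 1
    push_cast at h5 h6
    linarith
  · refine hvw ?_
    convert hz using 1
    push_cast at h7 h8
    linarith

theorem exists_nine_convex :
    ∃ F : Fin 9 → Set (EuclideanSpace ℝ (Fin 3)),
      (∀ i, Convex ℝ (F i)) ∧
      (∀ i : Fin 9, (G13 ∩ ⋂ j ∈ ({i}ᶜ : Finset (Fin 9)), F j).Nonempty) ∧
      (G13 ∩ ⋂ i, F i) = ∅ := by
  have h1 : (1 : ℝ) ∈ onePiExp := Submodule.subset_span (by simp)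
  obtain ⟨v, hv, w, hw, hv2, hw2, hvw⟩ := exists_half_notMem fg_onePiExp h1 irrational_pi
    (Submodule.subset_span (by simp))
  obtain ⟨N, hN⟩ := exists_nat_ge (max |v| |w|)
  simp only [max_le_iff] at hN
  obtain ⟨hvN, hwN⟩ := hN
  have hNmem : (N : ℝ) ∈ onePiExp := by simpa using nsmul_mem h1 N
  refine ⟨cornerHalfSpace v w N, convex_cornerHalfSpace v w N, fun i ↦ ?_,
    G13_inter_iInter_cornerHalfSpace hv2 hw2 hvw⟩
  refine ⟨cornerPoint v w N i, cornerPoint_mem_G13 hv hw hNmem i, ?_⟩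
  simp only [Set.mem_iInter, Finset.mem_compl, Finset.mem_singleton]
  exact fun j hj ↦ cornerPoint_mem_cornerHalfSpace hvN hwN hj

/-- The subgroup `G = ℤ² × ⟨1, π, e⟩` of `ℝ³` satisfies `h(G) ≥ 9`: there are nine convex
subsets of `ℝ³` any eight of which have a common point of `G`, while all nine together
contain no point of `G`; in particular `h(G) ≤ 8 = 2³` fails. -/
theorem subgroup_helly_ge_nine :
    (∃ F : Fin 9 → Set (EuclideanSpace ℝ (Fin 3)),
      (∀ i, Convex ℝ (F i)) ∧
      (∀ i : Fin 9, (G13 ∩ ⋂ j ∈ ({i}ᶜ : Finset (Fin 9)), F j).Nonempty) ∧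
      (G13 ∩ ⋂ i, F i) = ∅) ∧
    ¬ HellyLe G13 8 := by
  refine ⟨exists_nine_convex, fun h ↦ ?_⟩
  obtain ⟨F, hconv, hmeet, hempty⟩ := exists_nine_convex
  refine (h 9 F hconv fun I hI ↦ ?_).ne_empty hempty
  obtain ⟨i, hi⟩ : ∃ i, i ∉ I := by
    by_contra! hall
    have := Finset.card_le_card fun i (_ : i ∈ (Finset.univ : Finset (Fin 9))) ↦ hall i
    simp at this
    omega
  refine (hmeet i).mono (Set.inter_subset_inter_right _ (Set.biInter_mono ?_ fun _ _ ↦ subset_rfl))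
  intro j hj
  simp only [Finset.coe_compl, Finset.coe_singleton, Set.mem_compl_iff, Set.mem_singleton_iff]
  rintro rfl
  exact hi hj
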